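/- If κ is a weakly shrewd cardinal satisfying κ = κ^{<κ}, then κ is a strongly inaccessible (Mahlo) cardinal; in particular κ is a strong limit cardinal. -/

import Mathlib

universe u

open Cardinal

/-- Formulas of the language of set theory with an additional unary predicate
symbol `pred`; variables are indexed by natural numbers. -/
inductive SF : Type
  | mem : ℕ → ℕ → SF
  | eq : ℕ → ℕ → SF
  | pred : ℕ → SF
  | not : SF → SF
  | and : SF → SF → SF
  | ex : ℕ → SF → SF

/-- The free variables of a formula. -/
def SF.fv : SF → Set ℕ
  | .mem i j => {i, j}
  | .eq i j => {i, j}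
  | .pred i => {i}
  | .not φ => φ.fv
  | .and φ ψ => φ.fv ∪ ψ.fv
  | .ex k φ => φ.fv \ {k}

/-- Tarskian satisfaction of a formula in the structure whose carrier is the
class `S`, where the membership symbol is interpreted by the binary relation `E`
and the extra unary predicate symbol by the class `P`, under the valuation `v`. -/
def Sat (P : Set ZFSet.{u}) (E : ZFSet.{u} → ZFSet.{u} → Prop) (S : Set ZFSet.{u}) :
    SF → (ℕ → ZFSet.{u}) → Prop
  | .mem i j, v => E (v i) (v j)
  | .eq i j, v => v i = v j
  | .pred i, v => v i ∈ P
  | .not φ, v => ¬ Sat P E S φ v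
  | .and φ ψ, v => Sat P E S φ v ∧ Sat P E S ψ v
  | .ex k φ, v => ∃ x, x ∈ S ∧ Sat P E S φ (Function.update v k x)

/-- Satisfaction in the `∈`-structure with carrier `S`, the predicate symbol
being interpreted by the class `R`. -/
def SatIn (R : Set ZFSet.{u}) (S : Set ZFSet.{u}) (φ : SF) (v : ℕ → ZFSet.{u}) : Prop :=
  Sat R (· ∈ ·) S φ v

/-- Δ₀-formulas: built from atomic formulas by propositional connectives and
bounded existential quantification. -/
inductive IsDeltaZero : SF → Prop
  | mem (i j) : IsDeltaZero (.mem i j)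
  | eq (i j) : IsDeltaZero (.eq i j)
  | pred (i) : IsDeltaZero (.pred i)
  | not {φ} : IsDeltaZero φ → IsDeltaZero (.not φ)
  | and {φ ψ} : IsDeltaZero φ → IsDeltaZero ψ → IsDeltaZero (.and φ ψ)
  | bex {φ} (k j) : IsDeltaZero φ → IsDeltaZero (.ex k (.and (.mem k j) φ))

mutual
  /-- Σₙ-formulas of the Lévy hierarchy. -/
  inductive IsSigma : ℕ → SF → Prop
    | of_zero {φ} : IsDeltaZero φ → IsSigma 0 φ
    | of_pi {n φ} : IsPi n φ → IsSigma (n + 1) φ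
    | ex {n φ} (k) : IsSigma (n + 1) φ → IsSigma (n + 1) (.ex k φ)
  /-- Πₙ-formulas of the Lévy hierarchy. -/
  inductive IsPi : ℕ → SF → Prop
    | of_zero {φ} : IsDeltaZero φ → IsPi 0 φ
    | not {n φ} : IsSigma (n + 1) φ → IsPi (n + 1) (.not φ)
end

/-- The valuation sending `v₀` to `a`, `v₁` to `b` and all other variables to `∅`. -/
def val2 (a b : ZFSet.{u}) : ℕ → ZFSet.{u} := fun i => if i = 0 then a else if i = 1 then b else ∅

/-- `x` is a (von Neumann) ordinal. -/
def ZOrd (x : ZFSet.{u}) : Prop := x.IsTransitive ∧ ∀ y ∈ x, ZFSet.IsTransitive y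

/-- `κ` is a (von Neumann) cardinal. -/
def ZCard (κ : ZFSet.{u}) : Prop := ZOrd κ ∧ ∀ β ∈ κ, #β.toSet < #κ.toSet

/-- `κ` is an infinite cardinal. -/
def InfCard (κ : ZFSet.{u}) : Prop := ZCard κ ∧ ZFSet.omega ⊆ κ

/-- `κ` is an infinite regular cardinal: every cofinal subset of `κ` has
cardinality `κ`. -/
def ZRegular (κ : ZFSet.{u}) : Prop :=
  InfCard κ ∧ ∀ x : ZFSet.{u}, x ⊆ κ →
    (∀ β ∈ κ, ∃ γ ∈ x, β ∈ γ ∨ β = γ) → #x.toSet = #κ.toSet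

/-- `C` is a closed unbounded (class of) subset(s) of the ordinal `κ`. -/
def ZClub (C : Set ZFSet.{u}) (κ : ZFSet.{u}) : Prop :=
  (∀ γ ∈ C, γ ∈ κ) ∧ (∀ β ∈ κ, ∃ γ ∈ C, β ∈ γ) ∧
    (∀ β ∈ κ, (∃ γ, γ ∈ β) → (∀ γ ∈ β, ∃ δ ∈ C, γ ∈ δ ∧ δ ∈ β) → β ∈ C)

/-- `S` is stationary in `κ`: it meets every closed unbounded subset of `κ`. -/
def ZStationary (S : Set ZFSet.{u}) (κ : ZFSet.{u}) : Prop :=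
  ∀ C, ZClub C κ → ∃ γ ∈ C, γ ∈ S

/-- `H(θ)`: the class of all sets hereditarily of cardinality less than `θ`. -/
def HSet (θ : ZFSet.{u}) : Set ZFSet.{u} :=
  {x | ∃ t : ZFSet.{u}, t.IsTransitive ∧ x ⊆ t ∧ #t.toSet < #θ.toSet}

/-- `θ` is the cardinal successor `κ⁺` of `κ`. -/
def SuccCardOf (θ κ : ZFSet.{u}) : Prop :=
  ZCard θ ∧ κ ∈ θ ∧ ∀ μ, ZCard μ → κ ∈ μ → θ ⊆ μ

/-- `κ` is a weakly shrewd cardinal. -/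
def WeaklyShrewd (κ : ZFSet.{u}) : Prop :=
  InfCard κ ∧
    ∀ (φ : SF) (θ A : ZFSet.{u}), φ.fv ⊆ {0, 1} → ZCard θ → κ ∈ θ → A ⊆ κ →
      SatIn ∅ (HSet θ) φ (val2 A κ) →
      ∃ κ' θ' : ZFSet.{u}, ZCard κ' ∧ ZCard θ' ∧ κ' ∈ θ' ∧ κ' ∈ κ ∧
        SatIn ∅ (HSet θ') φ (val2 (A ∩ κ') κ')

/-- `j` is an elementary embedding of the `∈`-structure (with predicate `R`)
with carrier `X` into the one with carrier `Y`. -/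
def ElemEmbOn (R : Set ZFSet.{u}) (X Y : Set ZFSet.{u}) (j : ZFSet.{u} → ZFSet.{u}) : Prop :=
  (∀ x ∈ X, j x ∈ Y) ∧
    ∀ (φ : SF) (v : ℕ → ZFSet.{u}), (∀ i, v i ∈ X) →
      (SatIn R X φ v ↔ SatIn R Y φ (fun i => j (v i)))

/-- `X` is an elementary submodel of `Y` (as `∈`-structures with predicate `R`). -/
def ElemSub (R : Set ZFSet.{u}) (X Y : Set ZFSet.{u}) : Prop :=
  X ⊆ Y ∧ ∀ (φ : SF) (v : ℕ → ZFSet.{u}), (∀ i, v i ∈ X) → (SatIn R X φ v ↔ SatIn R Y φ v)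

/-- `X` is a Σₙ-elementary submodel of `Y`. -/
def SigmaElemSub (R : Set ZFSet.{u}) (n : ℕ) (X Y : Set ZFSet.{u}) : Prop :=
  X ⊆ Y ∧ ∀ (φ : SF), IsSigma n φ → ∀ (v : ℕ → ZFSet.{u}), (∀ i, v i ∈ X) →
    (SatIn R X φ v ↔ SatIn R Y φ v)

theorem HSet_mem {θ x y : ZFSet.{u}} (hx : x ∈ HSet θ) (hy : y ∈ x) : y ∈ HSet θ := by
  obtain ⟨t, ht, hxt, hc⟩ := hx
  exact ⟨t, ht, ht _ (hxt hy), hc⟩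

theorem HSet_sub {θ x y : ZFSet.{u}} (hx : x ∈ HSet θ) (hy : y ⊆ x) : y ∈ HSet θ := by
  obtain ⟨t, ht, hxt, hc⟩ := hx
  exact ⟨t, ht, fun z hz => hxt (hy hz), hc⟩

theorem mk_toSet_eq (x : ZFSet.{u}) : #x.toSet = Cardinal.lift.{u + 1, u} x.card :=
  ZFSet.cardinalMk_coe_sort

theorem mk_mono {x y : ZFSet.{u}} (h : x ⊆ y) : #x.toSet ≤ #y.toSet :=
  Cardinal.mk_le_mk_of_subset (fun _ hz => h hz)

theorem ZOrd.isOrdinal {x : ZFSet.{u}} (h : ZOrd x) : x.IsOrdinal :=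
  ZFSet.isOrdinal_iff_forall_mem_isTransitive.2 h

theorem mem_HSet_of_mem {κ θ : ZFSet.{u}} (hθ : ZCard θ) (hk : κ ∈ θ) : κ ∈ HSet θ :=
  ⟨κ, hθ.1.2 _ hk, fun _ h => h, hθ.2 _ hk⟩

theorem exists_theta (κ T : ZFSet.{u}) (hκ : ZOrd κ) :
    ∃ θ, ZCard θ ∧ κ ∈ θ ∧ T ∈ HSet θ := by
  set t := ZFSet.vonNeumann (ZFSet.rank T) with ht
  set c : Cardinal.{u} := Order.succ (max t.card κ.card) with hc
  have hoc : (c.ord.toZFSet).card = c := by simp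
  have hO : (c.ord.toZFSet).IsOrdinal := ZFSet.isOrdinal_toZFSet _
  refine ⟨c.ord.toZFSet, ⟨ZFSet.isOrdinal_iff_forall_mem_isTransitive.1 hO, ?_⟩, ?_, ?_⟩
  · intro β hβ
    obtain ⟨a, ha, rfl⟩ := Ordinal.mem_toZFSet_iff.1 hβ
    rw [mk_toSet_eq, mk_toSet_eq, hoc, Ordinal.card_toZFSet, Cardinal.lift_lt]
    exact Cardinal.lt_ord.1 ha
  · rw [← ZFSet.IsOrdinal.not_subset_iff_mem hO hκ.isOrdinal]
    intro hs
    have := ZFSet.card_mono hs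
    rw [hoc] at this
    exact absurd (this.trans (le_max_right t.card κ.card)) (not_le.2 (Order.lt_succ _))
  · refine ⟨t, ZFSet.isTransitive_vonNeumann _, ZFSet.subset_vonNeumann_self _, ?_⟩
    rw [mk_toSet_eq, mk_toSet_eq, hoc, Cardinal.lift_lt]
    exact (le_max_left t.card κ.card).trans_lt (Order.lt_succ _)

theorem mk_le_of_rel {X Y : Set ZFSet.{u}} (R : ZFSet.{u} → ZFSet.{u} → Prop)
    (h1 : ∀ x ∈ X, ∃ a ∈ Y, R a x)
    (h2 : ∀ a ∈ Y, ∀ x ∈ X, ∀ y ∈ X, R a x → R a y → x = y) : #X ≤ #Y := by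
  choose g hg hR using h1
  refine Cardinal.mk_le_of_injective (f := fun x : X => (⟨g x.1 x.2, hg x.1 x.2⟩ : Y)) ?_
  rintro ⟨x, hx⟩ ⟨y, hy⟩ hxy
  have he : g x hx = g y hy := congrArg Subtype.val hxy
  exact Subtype.ext (h2 _ (hg x hx) x hx y hy (hR x hx) (he ▸ hR y hy))

/-- Universal quantification. -/
def SF.all (k : ℕ) (φ : SF) : SF := .not (.ex k (.not φ))
/-- Implication. -/
def SF.imp (φ ψ : SF) : SF := .not (.and φ (.not ψ))

section
variable (P : Set ZFSet.{u}) (E : ZFSet.{u} → ZFSet.{u} → Prop) (S : Set ZFSet.{u})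
  (v : ℕ → ZFSet.{u})

theorem Sat_all (k φ) : Sat P E S (.all k φ) v ↔ ∀ x ∈ S, Sat P E S φ (Function.update v k x) := by
  simp [SF.all, Sat]

theorem Sat_imp (φ ψ) : Sat P E S (.imp φ ψ) v ↔ (Sat P E S φ v → Sat P E S ψ v) := by
  simp [SF.imp, Sat]

end

/-- `vᵢ = {vⱼ, vₖ}`. -/
def fUp (i j k : ℕ) : SF :=
  .and (.and (.mem j i) (.mem k i))
    (.all 9 (.imp (.mem 9 i) (.not (.and (.not (.eq 9 j)) (.not (.eq 9 k))))))

/-- `(vₐ, vₓ) ∈ v₂`. -/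
def fRel (a x : ℕ) : SF :=
  .ex 6 (.and (.mem 6 2) (.ex 7 (.ex 8 (.and (fUp 7 a a) (.and (fUp 8 a x) (fUp 6 7 8))))))

/-- `v₂` is functional. -/
def fFunc : SF :=
  .all 3 (.all 4 (.all 5 (.imp (fRel 3 4) (.imp (fRel 3 5) (.eq 4 5)))))

/-- `vᵢ ⊆ vⱼ`. -/
def fSub (i j : ℕ) : SF := .all 9 (.imp (.mem 9 i) (.mem 9 j))

section
variable {S : Set ZFSet.{u}}

theorem Sat_fUp (hS : ∀ x ∈ S, ∀ y ∈ x, y ∈ S) (v : ℕ → ZFSet.{u})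
    (i j k : ℕ) (hi : i ≠ 9) (hj : j ≠ 9) (hk : k ≠ 9) (h : v i ∈ S) :
    Sat ∅ (· ∈ ·) S (fUp i j k) v ↔ v i = {v j, v k} := by
  simp only [fUp, Sat, Sat_all, Sat_imp, Function.update_self, Function.update_of_ne hi,
    Function.update_of_ne hj, Function.update_of_ne hk]
  constructor
  · rintro ⟨⟨h1, h2⟩, h3⟩
    ext z
    rw [ZFSet.mem_pair]
    constructor
    · intro hz
      have := h3 z (hS _ h _ hz) hz
      tauto
    · rintro (rfl | rfl) <;> assumption
  · intro he
    rw [he]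
    refine ⟨by simp, ?_⟩
    intro z _ hz
    rw [ZFSet.mem_pair] at hz
    tauto

theorem Sat_fRel (hS : ∀ x ∈ S, ∀ y ∈ x, y ∈ S) (v : ℕ → ZFSet.{u})
    (a x : ℕ) (ha : a < 6) (hx : x < 6) (h : v 2 ∈ S) :
    Sat ∅ (· ∈ ·) S (fRel a x) v ↔ ZFSet.pair (v a) (v x) ∈ v 2 := by
  have e1 : a ≠ 6 := by omega
  have e2 : a ≠ 7 := by omega
  have e3 : a ≠ 8 := by omega
  have e4 : x ≠ 6 := by omega
  have e5 : x ≠ 7 := by omega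
  have e6 : x ≠ 8 := by omega
  have e7 : a ≠ 9 := by omega
  have e8 : x ≠ 9 := by omega
  have key : ∀ p ∈ S, ∀ s ∈ S, ∀ t ∈ S,
      (Sat ∅ (· ∈ ·) S (.and (fUp 7 a a) (.and (fUp 8 a x) (fUp 6 7 8)))
        (Function.update (Function.update (Function.update v 6 p) 7 s) 8 t)) ↔
      (s = {v a, v a} ∧ t = {v a, v x} ∧ p = {s, t}) := by
    intro p hp s hs t ht
    simp only [Sat]
    rw [Sat_fUp hS _ 7 a a (by decide) e7 e7 (by simpa using hs),
      Sat_fUp hS _ 8 a x (by decide) e7 e8 (by simpa using ht),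
      Sat_fUp hS _ 6 7 8 (by decide) (by decide) (by decide) (by simpa using hp)]
    simp [Function.update_of_ne, e1, e2, e3, e4, e5, e6]
  rw [fRel, Sat]
  constructor
  · rintro ⟨p, hp, h1, s, hs, t, ht, h2⟩
    obtain ⟨rfl, rfl, rfl⟩ := (key p hp s hs t ht).1 h2
    simpa [Sat, ZFSet.pair] using h1
  · intro hm
    have hp := hS _ h _ hm
    refine ⟨_, hp, by simpa [Sat] using hm, {v a, v a}, hS _ hp _ (by simp [ZFSet.pair]),
      {v a, v x}, hS _ hp _ (by simp [ZFSet.pair]), (key _ hp _ ?_ _ ?_).2 ?_⟩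
    · exact hS _ hp _ (by simp [ZFSet.pair])
    · exact hS _ hp _ (by simp [ZFSet.pair])
    · simp [ZFSet.pair]

theorem Sat_fFunc (hS : ∀ x ∈ S, ∀ y ∈ x, y ∈ S) (v : ℕ → ZFSet.{u})
    (h : v 2 ∈ S) :
    Sat ∅ (· ∈ ·) S fFunc v ↔ ∀ a ∈ S, ∀ x ∈ S, ∀ y ∈ S,
      ZFSet.pair a x ∈ v 2 → ZFSet.pair a y ∈ v 2 → x = y := by
  simp only [fFunc, Sat_all, Sat_imp]
  refine forall₂_congr fun a _ => forall₂_congr fun x _ => forall₂_congr fun y _ => ?_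
  rw [Sat_fRel hS _ 3 4 (by decide) (by decide) (by simpa using h),
    Sat_fRel hS _ 3 5 (by decide) (by decide) (by simpa using h)]
  simp [Sat, Function.update_of_ne]

theorem Sat_fSub (hS : ∀ x ∈ S, ∀ y ∈ x, y ∈ S) (v : ℕ → ZFSet.{u})
    (i j : ℕ) (hi : i ≠ 9) (hj : j ≠ 9) (h : v i ∈ S) :
    Sat ∅ (· ∈ ·) S (fSub i j) v ↔ v i ⊆ v j := by
  simp only [fSub, Sat, Sat_all, Sat_imp, Function.update_self, Function.update_of_ne hi,
    Function.update_of_ne hj]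
  exact ⟨fun H z hz => H z (hS _ h _ hz) hz, fun H z _ hz => H hz⟩

end

/-- `A ∈ κ` and some `f` maps `κ` onto the power set of `A`. -/
def phiPow : SF :=
  .and (.mem 0 1) (.ex 2 (.and fFunc (.all 4 (.imp (fSub 4 0) (.ex 3 (.and (.mem 3 1) (fRel 3 4)))))))

/-- `κ` is nonempty, `A` is unbounded in `κ` and every cofinal subset of `κ` maps onto `κ`. -/
def phiReg : SF :=
  .and (.ex 2 (.mem 2 1)) (.and (.all 3 (.imp (.mem 3 1) (.ex 4 (.and (.mem 4 0) (.mem 3 4)))))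
    (.all 5 (.imp (fSub 5 1) (.imp
      (.all 3 (.imp (.mem 3 1)
        (.ex 4 (.and (.mem 4 5) (.not (.and (.not (.mem 3 4)) (.not (.eq 3 4))))))))
      (.ex 2 (.and fFunc
        (.all 4 (.imp (.mem 4 1) (.ex 3 (.and (.mem 3 5) (fRel 3 4)))))))))))

theorem fv_phiPow : phiPow.fv ⊆ {0, 1} := by
  intro n hn
  simp [phiPow, fFunc, fSub, fRel, fUp, SF.all, SF.imp, SF.fv] at hn
  simp only [Set.mem_insert_iff, Set.mem_singleton_iff]
  omega

theorem fv_phiReg : phiReg.fv ⊆ {0, 1} := by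
  intro n hn
  simp [phiReg, fFunc, fSub, fRel, fUp, SF.all, SF.imp, SF.fv] at hn
  simp only [Set.mem_insert_iff, Set.mem_singleton_iff]
  omega

section
variable {S : Set ZFSet.{u}}

theorem Sat_phiPow (hS : ∀ x ∈ S, ∀ y ∈ x, y ∈ S) (A κ : ZFSet.{u}) :
    SatIn ∅ S phiPow (val2 A κ) ↔ A ∈ κ ∧ ∃ f ∈ S,
      (∀ a ∈ S, ∀ x ∈ S, ∀ y ∈ S, ZFSet.pair a x ∈ f → ZFSet.pair a y ∈ f → x = y) ∧
      ∀ x ∈ S, x ⊆ A → ∃ a ∈ S, a ∈ κ ∧ ZFSet.pair a x ∈ f := by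
  simp only [SatIn, phiPow, Sat, Sat_all, Sat_imp]
  refine and_congr (by simp [val2]) (exists_congr fun f => and_congr_right fun hf => ?_)
  rw [Sat_fFunc hS _ (by simpa using hf)]
  refine and_congr (by simp) (forall₂_congr fun x hx => ?_)
  rw [Sat_fSub hS _ 4 0 (by decide) (by decide) (by simpa using hx)]
  refine imp_congr (by simp [val2, Function.update_of_ne]) (exists_congr fun a =>
    and_congr_right fun ha => and_congr (by simp [val2, Function.update_of_ne]) ?_)
  rw [Sat_fRel hS _ 3 4 (by decide) (by decide) (by simpa using hf)]
  simp [Function.update_of_ne]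

theorem Sat_phiReg (hS : ∀ x ∈ S, ∀ y ∈ x, y ∈ S) (A κ : ZFSet.{u}) :
    SatIn ∅ S phiReg (val2 A κ) ↔ (∃ z ∈ S, z ∈ κ) ∧
      (∀ y ∈ S, y ∈ κ → ∃ z ∈ S, z ∈ A ∧ y ∈ z) ∧
      (∀ x ∈ S, x ⊆ κ → (∀ b ∈ S, b ∈ κ → ∃ c ∈ S, c ∈ x ∧ (b ∈ c ∨ b = c)) →
        ∃ f ∈ S,
        (∀ a ∈ S, ∀ x ∈ S, ∀ y ∈ S, ZFSet.pair a x ∈ f → ZFSet.pair a y ∈ f → x = y) ∧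
        ∀ y ∈ S, y ∈ κ → ∃ a ∈ S, a ∈ x ∧ ZFSet.pair a y ∈ f) := by
  simp only [SatIn, phiReg, Sat, Sat_all, Sat_imp]
  refine and_congr (by simp [val2]) (and_congr (by simp [val2, Function.update_of_ne])
    (forall₂_congr fun x hx => ?_))
  rw [Sat_fSub hS _ 5 1 (by decide) (by decide) (by simpa using hx)]
  refine imp_congr (by simp [val2, Function.update_of_ne]) (imp_congr ?_
    (exists_congr fun f => and_congr_right fun hf => ?_))
  · simp [val2, Function.update_of_ne, or_iff_not_imp_left]
  rw [Sat_fFunc hS _ (by simpa using hf)]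
  refine and_congr (by simp) (forall₂_congr fun y hy => ?_)
  refine imp_congr (by simp [val2, Function.update_of_ne]) (exists_congr fun a =>
    and_congr_right fun ha => and_congr (by simp [Function.update_of_ne]) ?_)
  rw [Sat_fRel hS _ 3 4 (by decide) (by decide) (by simpa using hf)]
  simp [Function.update_of_ne]

end

theorem nat_mem_omega (n : ℕ) : (n : Ordinal.{u}).toZFSet ∈ ZFSet.omega.{u} := by
  induction n with
  | zero => simp
  | succ n ih => simpa using ZFSet.omega_succ ih

theorem aleph0_le_of_inf {κ : ZFSet.{u}} (h : InfCard κ) : ℵ₀ ≤ #κ.toSet := by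
  rw [Cardinal.aleph0_le_mk_iff]
  refine Infinite.of_injective
    (fun n : ℕ => (⟨(n : Ordinal.{u}).toZFSet, h.2 (nat_mem_omega n)⟩ : κ.toSet)) ?_
  intro m n hmn
  have := Ordinal.toZFSet_injective (congrArg Subtype.val hmn)
  exact_mod_cast this

theorem omega_sub_of_limit {κ : ZFSet.{u}} (hκ : ZOrd κ) (h0 : ∃ z, z ∈ κ)
    (hs : ∀ y ∈ κ, ∃ z ∈ κ, y ∈ z) : ZFSet.omega ⊆ κ := by
  have hO := hκ.isOrdinal
  have h : ∀ n : ℕ, ZFSet.mk (PSet.ofNat n) ∈ κ := by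
    intro n
    induction n with
    | zero =>
      obtain ⟨z, hz⟩ := h0
      exact ZFSet.isOrdinal_empty.mem_of_subset_of_mem hO (ZFSet.empty_subset z) hz
    | succ n ih =>
      obtain ⟨z, hz, hm⟩ := hs _ ih
      have : insert (ZFSet.mk (PSet.ofNat n)) (ZFSet.mk (PSet.ofNat n)) ∈ κ := by
        refine (ZFSet.isOrdinal_succ (hO.mem ih)).mem_of_subset_of_mem hO ?_ hz
        intro w hw
        rcases ZFSet.mem_insert_iff.1 hw with rfl | hw
        · exact hm
        · exact hκ.2 z hz _ hm hw
      exact this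
  intro x
  refine Quotient.inductionOn x ?_
  rintro p ⟨⟨n⟩, hn⟩
  have : (ZFSet.mk p) = ZFSet.mk (PSet.ofNat n) := Quotient.sound hn
  change ZFSet.mk p ∈ κ
  rw [this]
  exact h n

theorem succ_mem {κ y : ZFSet.{u}} (h : InfCard κ) (hy : y ∈ κ) :
    #(insert y y : ZFSet.{u}).toSet < #κ.toSet := by
  have h1 : #(insert y y : ZFSet.{u}).toSet ≤ #y.toSet + 1 := by
    rw [mk_toSet_eq, mk_toSet_eq, ← Cardinal.lift_one.{u, u + 1}, ← Cardinal.lift_add, Cardinal.lift_le]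
    exact ZFSet.card_insert_le
  exact h1.trans_lt (Cardinal.add_lt_of_lt (aleph0_le_of_inf h) (h.1.2 _ hy)
    (Cardinal.one_lt_aleph0.trans_le (aleph0_le_of_inf h)))

theorem regular_of_pow {κ : ZFSet.{u}} (h : InfCard κ)
    (hpow : #κ.toSet ^< #κ.toSet = #κ.toSet) : ZRegular κ := by
  refine ⟨h, fun x hx hcof => le_antisymm (mk_mono hx) (not_lt.1 fun hlt => ?_)⟩
  have h1 : #κ.toSet ≤ Cardinal.sum fun γ : x.toSet => #(insert γ.1 γ.1 : ZFSet.{u}).toSet := by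
    rw [← Cardinal.mk_sigma]
    refine Cardinal.mk_le_of_surjective
      (f := fun p : Σ γ : x.toSet, (insert γ.1 γ.1 : ZFSet.{u}).toSet =>
        (⟨p.2.1, ?_⟩ : κ.toSet)) ?_
    · rcases ZFSet.mem_insert_iff.1 p.2.2 with e | e
      · rw [e]; exact hx p.1.2
      · exact h.1.1.1 _ (hx p.1.2) e
    · rintro ⟨β, hβ⟩
      obtain ⟨γ, hγ, e⟩ := hcof β hβ
      exact ⟨⟨⟨γ, hγ⟩, ⟨β, ZFSet.mem_insert_iff.2 e.symm⟩⟩, rfl⟩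
  have h2 := Cardinal.sum_lt_prod (fun γ : x.toSet => #(insert γ.1 γ.1 : ZFSet.{u}).toSet)
    (fun _ => #κ.toSet) (fun γ => succ_mem h (hx γ.2))
  rw [Cardinal.prod_const, Cardinal.lift_id, Cardinal.lift_id] at h2
  have h3 := Cardinal.le_powerlt #κ.toSet hlt
  rw [hpow] at h3
  exact absurd (h1.trans_lt (h2.trans_le h3)) (lt_irrefl _)

/-- The graph of a function on `X`. -/
theorem exists_graph (X Y : ZFSet.{u}) (g : ZFSet.{u} → ZFSet.{u}) :
    ∃ f, f ⊆ ZFSet.prod X Y ∧ ∀ a x, ZFSet.pair a x ∈ f ↔ (a ∈ X ∧ x ∈ Y ∧ x = g a) := by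
  refine ⟨ZFSet.sep (fun p => ∃ a, p = ZFSet.pair a (g a)) (ZFSet.prod X Y),
    ZFSet.sep_subset, fun a x => ?_⟩
  rw [ZFSet.mem_sep, ZFSet.pair_mem_prod, and_assoc]
  refine and_congr_right fun _ => and_congr_right fun _ => ?_
  constructor
  · rintro ⟨b, hb⟩
    obtain ⟨rfl, rfl⟩ := ZFSet.pair_inj.1 hb
    rfl
  · rintro rfl
    exact ⟨a, rfl⟩

/-- If `#Y ≤ #X` there is a function whose graph covers `Y`. -/
theorem exists_onto {X Y : ZFSet.{u}} (h : #Y.toSet ≤ #X.toSet) :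
    ∃ f, f ⊆ ZFSet.prod X Y ∧
      (∀ a x y, ZFSet.pair a x ∈ f → ZFSet.pair a y ∈ f → x = y) ∧
      ∀ y ∈ Y, ∃ a ∈ X, ZFSet.pair a y ∈ f := by
  classical
  obtain ⟨e⟩ := h
  let g : ZFSet.{u} → ZFSet.{u} := fun a =>
    if ha : ∃ y : Y.toSet, (e y).1 = a then (Classical.choose ha).1 else ∅
  have hg : ∀ y : Y.toSet, g (e y).1 = y.1 := by
    intro y
    have hex : ∃ y' : Y.toSet, (e y').1 = (e y).1 := ⟨y, rfl⟩
    have : g (e y).1 = (Classical.choose hex).1 := dif_pos hex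
    rw [this]
    exact congrArg Subtype.val (e.injective (Subtype.ext (Classical.choose_spec hex)))
  obtain ⟨f, hf, hm⟩ := exists_graph X Y g
  refine ⟨f, hf, fun a x y h1 h2 => ?_, fun y hy => ?_⟩
  · rw [((hm _ _).1 h1).2.2, ((hm _ _).1 h2).2.2]
  · exact ⟨(e ⟨y, hy⟩).1, (e ⟨y, hy⟩).2, (hm _ _).2 ⟨(e ⟨y, hy⟩).2, hy, (hg ⟨y, hy⟩).symm⟩⟩

theorem mk_powerset_toSet (μ : ZFSet.{u}) :
    #(ZFSet.powerset μ).toSet = (2 : Cardinal.{u + 1}) ^ #μ.toSet := by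
  rw [mk_toSet_eq, mk_toSet_eq, ZFSet.card_powerset, Cardinal.lift_power, Cardinal.lift_two]

theorem strongLimit_of_shrewd {κ : ZFSet.{u}} (h : WeaklyShrewd κ)
    (hpow : #κ.toSet ^< #κ.toSet = #κ.toSet) (μ : ZFSet.{u}) (hμ : μ ∈ κ) :
    (2 : Cardinal.{u + 1}) ^ #μ.toSet < #κ.toSet := by
  have hO := h.1.1.1
  have hle : (2 : Cardinal.{u + 1}) ^ #μ.toSet ≤ #κ.toSet := by
    calc (2 : Cardinal.{u + 1}) ^ #μ.toSet ≤ #κ.toSet ^ #μ.toSet :=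
          Cardinal.power_le_power_right
            ((Cardinal.ofNat_lt_aleph0.le).trans (aleph0_le_of_inf h.1))
      _ ≤ #κ.toSet ^< #κ.toSet := Cardinal.le_powerlt _ (h.1.1.2 _ hμ)
      _ = _ := hpow
  refine lt_of_le_of_ne hle fun heq => ?_
  obtain ⟨f, hf, hfun, hon⟩ := exists_onto (X := κ) (Y := ZFSet.powerset μ)
    (by rw [mk_powerset_toSet]; exact heq.le)
  obtain ⟨θ, hθ, hκθ, hT⟩ := exists_theta κ f hO
  have hS : ∀ θ : ZFSet.{u}, ∀ x ∈ HSet θ, ∀ y ∈ x, y ∈ HSet θ :=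
    fun θ x hx y hy => HSet_mem hx hy
  have hκH := mem_HSet_of_mem hθ hκθ
  obtain ⟨κ', θ', hκ', hθ', h1, h2, h3⟩ := h.2 phiPow θ μ fv_phiPow hθ hκθ (hO.1 _ hμ)
    ((Sat_phiPow (hS θ) μ κ).2 ⟨hμ, f, hT, fun a _ x _ y _ => hfun a x y, fun x _ hx => by
      obtain ⟨a, ha, hp⟩ := hon x (ZFSet.mem_powerset.2 hx)
      exact ⟨a, HSet_mem hκH ha, ha, hp⟩⟩)
  obtain ⟨hmem, g, hg, gfun, gon⟩ := (Sat_phiPow (hS θ') _ _).1 h3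
  have hsub : μ ∩ κ' = μ := by
    rcases hO.isOrdinal.mem hμ |>.mem_or_subset hκ'.1.isOrdinal with e | e
    · ext z
      rw [ZFSet.mem_inter]
      exact ⟨fun q => q.1, fun q => ⟨q, hκ'.1.1 _ e q⟩⟩
    · have : μ ∩ κ' = κ' := by
        ext z
        rw [ZFSet.mem_inter]
        exact ⟨fun q => q.2, fun q => ⟨e q, q⟩⟩
      rw [this] at hmem
      exact absurd hmem (ZFSet.mem_irrefl _)
  rw [hsub] at hmem gon
  have hκH' := mem_HSet_of_mem hθ' h1
  have hμH := HSet_mem hκH' hmem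
  have hc : #(ZFSet.powerset μ).toSet ≤ #κ'.toSet := by
    refine mk_le_of_rel (fun a x => ZFSet.pair a x ∈ g) (fun x hx => ?_) ?_
    · have hx' : x ⊆ μ := ZFSet.mem_powerset.1 hx
      obtain ⟨a, _, ha, hp⟩ := gon x (HSet_sub hμH hx') hx'
      exact ⟨a, ha, hp⟩
    · intro a ha x hx y hy
      exact gfun a (HSet_mem hκH' ha) x (HSet_sub hμH (ZFSet.mem_powerset.1 hx))
        y (HSet_sub hμH (ZFSet.mem_powerset.1 hy))
  rw [mk_powerset_toSet, heq] at hc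
  exact absurd hc (not_le.2 (h.1.1.2 _ h2))

theorem stationary_of_shrewd {κ : ZFSet.{u}} (h : WeaklyShrewd κ) (hreg : ZRegular κ) :
    ZStationary {β : ZFSet.{u} | ZRegular β} κ := by
  intro C hC
  have hO := h.1.1.1
  have hS : ∀ θ : ZFSet.{u}, ∀ x ∈ HSet θ, ∀ y ∈ x, y ∈ HSet θ :=
    fun θ x hx y hy => HSet_mem hx hy
  obtain ⟨θ, hθ, hκθ, hT⟩ := exists_theta κ (ZFSet.prod κ κ) hO
  have hκH := mem_HSet_of_mem hθ hκθ
  let A : ZFSet.{u} := ZFSet.sep (fun z => z ∈ C) κ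
  have hA : ∀ z, z ∈ A ↔ z ∈ κ ∧ z ∈ C := fun z => ZFSet.mem_sep
  have hsat : SatIn ∅ (HSet θ) phiReg (val2 A κ) := by
    refine (Sat_phiReg (hS θ) A κ).2 ⟨?_, ?_, ?_⟩
    · exact ⟨∅, HSet_mem hκH (h.1.2 ZFSet.omega_zero), h.1.2 ZFSet.omega_zero⟩
    · intro y _ hy
      obtain ⟨γ, hγ, hyγ⟩ := hC.2.1 y hy
      exact ⟨γ, HSet_mem hκH (hC.1 _ hγ), (hA _).2 ⟨hC.1 _ hγ, hγ⟩, hyγ⟩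
    · intro x _ hx hcof
      have hcard : #x.toSet = #κ.toSet := hreg.2 x hx fun β hβ => by
        obtain ⟨c, _, hc, e⟩ := hcof β (HSet_mem hκH hβ) hβ
        exact ⟨c, hc, e⟩
      obtain ⟨f, hf, hfun, hon⟩ := exists_onto (X := x) (Y := κ) hcard.ge
      refine ⟨f, HSet_sub hT fun p hp => ?_, fun a _ x _ y _ => hfun a x y, fun y _ hy => ?_⟩
      · obtain ⟨a, ha, b, hb, rfl⟩ := ZFSet.mem_prod.1 (hf hp)
        exact ZFSet.pair_mem_prod.2 ⟨hx ha, hb⟩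
      · obtain ⟨a, ha, hp⟩ := hon y hy
        exact ⟨a, HSet_mem hκH (hx ha), ha, hp⟩
  obtain ⟨κ', θ', hκ', hθ', h1, h2, h3⟩ := h.2 phiReg θ A fv_phiReg hθ hκθ
    (fun z hz => ((hA z).1 hz).1) hsat
  obtain ⟨⟨z0, _, hz0⟩, hunb, hr⟩ := (Sat_phiReg (hS θ') _ _).1 h3
  have hκH' := mem_HSet_of_mem hθ' h1
  have hunb' : ∀ γ ∈ κ', ∃ δ ∈ C, γ ∈ δ ∧ δ ∈ κ' := by
    intro γ hγ
    obtain ⟨z, _, hz, hγz⟩ := hunb γ (HSet_mem hκH' hγ) hγ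
    rw [ZFSet.mem_inter, hA] at hz
    exact ⟨z, hz.1.2, hγz, hz.2⟩
  refine ⟨κ', hC.2.2 κ' h2 ⟨z0, hz0⟩ hunb', ⟨hκ', ?_⟩, ?_⟩
  · refine omega_sub_of_limit hκ'.1 ⟨z0, hz0⟩ fun y hy => ?_
    obtain ⟨δ, _, h4, h5⟩ := hunb' y hy
    exact ⟨δ, h5, h4⟩
  · intro x hx hcof
    refine le_antisymm (mk_mono hx) ?_
    obtain ⟨f, _, hfun, hon⟩ := hr x (HSet_sub hκH' hx) hx fun b _ hb => by
      obtain ⟨c, hc, e⟩ := hcof b hb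
      exact ⟨c, HSet_mem hκH' (hx hc), hc, e⟩
    refine mk_le_of_rel (fun a x => ZFSet.pair a x ∈ f) (fun y hy => ?_) ?_
    · obtain ⟨a, _, ha, hp⟩ := hon y (HSet_mem hκH' hy) hy
      exact ⟨a, ha, hp⟩
    · intro a ha x' hx' y hy
      exact hfun a (HSet_mem hκH' (hx ha)) x' (HSet_mem hκH' hx') y (HSet_mem hκH' hy)

/-- If `κ` is a weakly shrewd cardinal satisfying `κ = κ^{<κ}`, then `κ` is a
strongly inaccessible (Mahlo) cardinal: `κ` is regular, a strong limit, and the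
regular cardinals below `κ` are stationary in `κ`. -/
theorem weaklyShrewd_mahlo (κ : ZFSet.{u}) (h : WeaklyShrewd κ)
    (hpow : #κ.toSet ^< #κ.toSet = #κ.toSet) :
    ZRegular κ ∧ (∀ μ ∈ κ, (2 : Cardinal.{u + 1}) ^ #μ.toSet < #κ.toSet) ∧
      ZStationary {β : ZFSet.{u} | ZRegular β} κ := by
  have hreg := regular_of_pow h.1 hpow
  exact ⟨hreg, strongLimit_of_shrewd h hpow, stationary_of_shrewd h hreg⟩
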